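/- There do not exist an open interval I ⊆ ℝ containing 0, smooth functions x, y, r, c : I → ℝ with r > 0 on I, a real number α ≠ 0, and a point τ₀ ∈ I with c(τ₀) ≠ 0, such that on I: x''(τ) = α·τ·r(τ)², y'' = 0, r'' = r + c·r², c'' = c, and x'² + y'² + r'² = r². -/

import Mathlib

open Set

lemma zero_of_deriv {lo hi : ℝ} {F : ℝ → ℝ} (hF : ∀ s ∈ Ioo lo hi, F s = 0) {s F' : ℝ}
    (hs : s ∈ Ioo lo hi) (h : HasDerivAt F F' s) : F' = 0 := by
  have h0 : HasDerivAt F 0 s := by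
    refine (hasDerivAt_const s (0 : ℝ)).congr_of_eventuallyEq ?_
    filter_upwards [isOpen_Ioo.mem_nhds hs] with t ht using hF t ht
  exact h.unique h0

lemma mono_deriv {r p c d : ℝ → ℝ} {s r' p' c' d' : ℝ} (hr : HasDerivAt r r' s)
    (hp : HasDerivAt p p' s) (hc : HasDerivAt c c' s) (hd : HasDerivAt d d' s)
    (k : ℝ) (i j l m n : ℕ) :
    HasDerivAt (fun s => k * s ^ i * r s ^ j * p s ^ l * c s ^ m * d s ^ n)
      (k * (i * s ^ (i - 1)) * r s ^ j * p s ^ l * c s ^ m * d s ^ n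
       + k * s ^ i * (j * r s ^ (j - 1) * r') * p s ^ l * c s ^ m * d s ^ n
       + k * s ^ i * r s ^ j * (l * p s ^ (l - 1) * p') * c s ^ m * d s ^ n
       + k * s ^ i * r s ^ j * p s ^ l * (m * c s ^ (m - 1) * c') * d s ^ n
       + k * s ^ i * r s ^ j * p s ^ l * c s ^ m * (n * d s ^ (n - 1) * d')) s := by
  have := (((((hasDerivAt_pow i s).const_mul k).mul (hr.pow j)).mul (hp.pow l)).mul
    (hc.pow m)).mul (hd.pow n)
  refine this.congr_deriv ?_
  simp only [Pi.mul_apply, Pi.pow_apply]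
  ring

lemma smooth_derivs {lo hi : ℝ} {f : ℝ → ℝ} (hf : ContDiffOn ℝ (⊤ : ℕ∞) f (Ioo lo hi)) :
    ∀ s ∈ Ioo lo hi, HasDerivAt f (deriv f s) s ∧
      HasDerivAt (deriv f) (deriv (deriv f) s) s := by
  intro s hs
  have hn := isOpen_Ioo.mem_nhds hs
  have h1 : ContDiffOn ℝ 1 (deriv f) (Ioo lo hi) :=
    hf.deriv_of_isOpen isOpen_Ioo (WithTop.coe_le_coe.2 (le_top : (1 + 1 : ℕ∞) ≤ ⊤))
  exact ⟨((hf.contDiffAt hn).differentiableAt (by simp)).hasDerivAt,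
    ((h1.contDiffAt hn).differentiableAt (by simp)).hasDerivAt⟩

lemma final_alg (k m A : ℝ) (hA : 0 < A)
    (h0 : m * (2 + 3 * k) = 0)
    (h1 : 3 * A + 3 * m ^ 2 + 4 * k + 7 * k ^ 2 + 2 * k ^ 3 = 0)
    (h2 : m * (8 + 34 * k + 16 * k ^ 2) = 0)
    (h3 : 30 * A + 50 * m ^ 2 + 16 * k + 30 * k * A + 48 * k * m ^ 2 + 70 * k ^ 2
      + 54 * k ^ 3 + 10 * k ^ 4 = 0) : False := by
  have hm : m = 0 := by
    by_contra hm
    have e0 := (mul_eq_zero.mp h0).resolve_left hm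
    have e2 := (mul_eq_zero.mp h2).resolve_left hm
    have : k = -2 / 3 := by linarith
    subst this
    norm_num at e2
  subst hm
  have hk : k ≠ 0 := by
    rintro rfl
    linarith
  have e : k * (12 + 20 * k + 18 * k ^ 2 + 5 * k ^ 3) = 0 := by
    linear_combination (-1 / 2) * h3 + 5 * (1 + k) * h1
  have e := (mul_eq_zero.mp e).resolve_left hk
  have l1 : -(5 / 2) < k := by
    by_contra h
    push Not at h
    nlinarith [mul_nonneg (sub_nonneg.2 h) (sq_nonneg (k + 1)), mul_nonneg (sub_nonneg.2 h) (sq_nonneg k)]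
  have l2 : k < -(11 / 5) := by
    by_contra h
    push Not at h
    have h' : 0 ≤ k + 11 / 5 := by linarith
    nlinarith [mul_nonneg h' (sq_nonneg (k + 7 / 10))]
  nlinarith [mul_pos (sub_pos.2 l1) (sub_pos.2 l2)]

set_option maxHeartbeats 8000000 in
lemma core {lo hi α : ℝ} {u v r p c d : ℝ → ℝ} (h0 : (0 : ℝ) ∈ Ioo lo hi) (hα : α ≠ 0)
    (hpos : ∀ s ∈ Ioo lo hi, 0 < r s)
    (hu : ∀ s ∈ Ioo lo hi, HasDerivAt u (α * s * r s ^ 2) s)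
    (hv : ∀ s ∈ Ioo lo hi, HasDerivAt v 0 s)
    (hr : ∀ s ∈ Ioo lo hi, HasDerivAt r (p s) s)
    (hp : ∀ s ∈ Ioo lo hi, HasDerivAt p (r s + c s * r s ^ 2) s)
    (hc : ∀ s ∈ Ioo lo hi, HasDerivAt c (d s) s)
    (hd : ∀ s ∈ Ioo lo hi, HasDerivAt d (c s) s)
    (harc : ∀ s ∈ Ioo lo hi, u s ^ 2 + v s ^ 2 + p s ^ 2 - r s ^ 2 = 0) : False := by
  have F0 : ∀ s ∈ Ioo lo hi, α * (s * u s) + c s * p s = 0 := by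
    intro s hs
    have := zero_of_deriv harc hs (((((hu s hs).pow 2).add ((hv s hs).pow 2)).add
      ((hp s hs).pow 2)).sub ((hr s hs).pow 2))
    have h2 : r s ^ 2 * (α * (s * u s) + c s * p s) = 0 := by
      norm_num at this
      linear_combination (1 / 2) * this
    exact (mul_eq_zero.mp h2).resolve_left (pow_ne_zero _ (hpos s hs).ne')
  have F1 : ∀ s ∈ Ioo lo hi, α * u s + α ^ 2 * s ^ 2 * r s ^ 2 + d s * p s + c s * r s
      + c s ^ 2 * r s ^ 2 = 0 := by
    intro s hs
    have := zero_of_deriv F0 hs ((((hasDerivAt_id s).mul (hu s hs)).const_mul α).add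
      ((hc s hs).mul (hp s hs)))
    simp only [id] at this
    linear_combination this
  have H := fun (k : ℝ) (i j l m n : ℕ) (s : ℝ) (hs : s ∈ Ioo lo hi) =>
    mono_deriv (hr s hs) (hp s hs) (hc s hs) (hd s hs) k i j l m n
  have F1' : ∀ s ∈ Ioo lo hi, α * u s + (α ^ 2 * s ^ 2 * r s ^ 2 * p s ^ 0 * c s ^ 0 * d s ^ 0 +
      1 * s ^ 0 * r s ^ 0 * p s ^ 1 * c s ^ 0 * d s ^ 1 +
      1 * s ^ 0 * r s ^ 1 * p s ^ 0 * c s ^ 1 * d s ^ 0 +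
      1 * s ^ 0 * r s ^ 2 * p s ^ 0 * c s ^ 2 * d s ^ 0) = 0 := by
    intro s hs
    linear_combination F1 s hs
  have K0 : ∀ s ∈ Ioo lo hi, (2 * α ^ 0) * s ^ 0 * r s ^ 0 * p s ^ 1 * c s ^ 1 * d s ^ 0 +
      (2 * α ^ 0) * s ^ 0 * r s ^ 1 * p s ^ 0 * c s ^ 0 * d s ^ 1 +
      (2 * α ^ 0) * s ^ 0 * r s ^ 1 * p s ^ 1 * c s ^ 2 * d s ^ 0 +
      (3 * α ^ 0) * s ^ 0 * r s ^ 2 * p s ^ 0 * c s ^ 1 * d s ^ 1 +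
      (3 * α ^ 2) * s ^ 1 * r s ^ 2 * p s ^ 0 * c s ^ 0 * d s ^ 0 +
      (2 * α ^ 2) * s ^ 2 * r s ^ 1 * p s ^ 1 * c s ^ 0 * d s ^ 0 = 0 := by
    intro s hs
    have := zero_of_deriv F1' hs (((hu s hs).const_mul α).add
      ((((H (α ^ 2) 2 2 0 0 0 s hs).add (H 1 0 0 1 0 1 s hs)).add (H 1 0 1 0 1 0 s hs)).add
        (H 1 0 2 0 2 0 s hs)))
    norm_num at this
    linear_combination this
  have K1 : ∀ s ∈ Ioo lo hi, (4 * α ^ 0) * s ^ 0 * r s ^ 0 * p s ^ 1 * c s ^ 0 * d s ^ 1 +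
      (2 * α ^ 0) * s ^ 0 * r s ^ 0 * p s ^ 2 * c s ^ 2 * d s ^ 0 +
      (4 * α ^ 0) * s ^ 0 * r s ^ 1 * p s ^ 0 * c s ^ 1 * d s ^ 0 +
      (10 * α ^ 0) * s ^ 0 * r s ^ 1 * p s ^ 1 * c s ^ 1 * d s ^ 1 +
      (3 * α ^ 2) * s ^ 0 * r s ^ 2 * p s ^ 0 * c s ^ 0 * d s ^ 0 +
      (3 * α ^ 0) * s ^ 0 * r s ^ 2 * p s ^ 0 * c s ^ 0 * d s ^ 2 +
      (7 * α ^ 0) * s ^ 0 * r s ^ 2 * p s ^ 0 * c s ^ 2 * d s ^ 0 +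
      (2 * α ^ 0) * s ^ 0 * r s ^ 3 * p s ^ 0 * c s ^ 3 * d s ^ 0 +
      (10 * α ^ 2) * s ^ 1 * r s ^ 1 * p s ^ 1 * c s ^ 0 * d s ^ 0 +
      (2 * α ^ 2) * s ^ 2 * r s ^ 0 * p s ^ 2 * c s ^ 0 * d s ^ 0 +
      (2 * α ^ 2) * s ^ 2 * r s ^ 2 * p s ^ 0 * c s ^ 0 * d s ^ 0 +
      (2 * α ^ 2) * s ^ 2 * r s ^ 3 * p s ^ 0 * c s ^ 1 * d s ^ 0 = 0 := by
    intro s hs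
    have := zero_of_deriv K0 hs ((((((H (2 * α ^ 0) 0 0 1 1 0 s hs).add
      (H (2 * α ^ 0) 0 1 0 0 1 s hs)).add
      (H (2 * α ^ 0) 0 1 1 2 0 s hs)).add
      (H (3 * α ^ 0) 0 2 0 1 1 s hs)).add
      (H (3 * α ^ 2) 1 2 0 0 0 s hs)).add
      (H (2 * α ^ 2) 2 1 1 0 0 s hs))
    norm_num at this
    linear_combination this
  have K2 : ∀ s ∈ Ioo lo hi, (8 * α ^ 0) * s ^ 0 * r s ^ 0 * p s ^ 1 * c s ^ 1 * d s ^ 0 +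
      (14 * α ^ 0) * s ^ 0 * r s ^ 0 * p s ^ 2 * c s ^ 1 * d s ^ 1 +
      (8 * α ^ 0) * s ^ 0 * r s ^ 1 * p s ^ 0 * c s ^ 0 * d s ^ 1 +
      (16 * α ^ 2) * s ^ 0 * r s ^ 1 * p s ^ 1 * c s ^ 0 * d s ^ 0 +
      (16 * α ^ 0) * s ^ 0 * r s ^ 1 * p s ^ 1 * c s ^ 0 * d s ^ 2 +
      (28 * α ^ 0) * s ^ 0 * r s ^ 1 * p s ^ 1 * c s ^ 2 * d s ^ 0 +
      (34 * α ^ 0) * s ^ 0 * r s ^ 2 * p s ^ 0 * c s ^ 1 * d s ^ 1 +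
      (10 * α ^ 0) * s ^ 0 * r s ^ 2 * p s ^ 1 * c s ^ 3 * d s ^ 0 +
      (16 * α ^ 0) * s ^ 0 * r s ^ 3 * p s ^ 0 * c s ^ 2 * d s ^ 1 +
      (14 * α ^ 2) * s ^ 1 * r s ^ 0 * p s ^ 2 * c s ^ 0 * d s ^ 0 +
      (14 * α ^ 2) * s ^ 1 * r s ^ 2 * p s ^ 0 * c s ^ 0 * d s ^ 0 +
      (14 * α ^ 2) * s ^ 1 * r s ^ 3 * p s ^ 0 * c s ^ 1 * d s ^ 0 +
      (8 * α ^ 2) * s ^ 2 * r s ^ 1 * p s ^ 1 * c s ^ 0 * d s ^ 0 +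
      (10 * α ^ 2) * s ^ 2 * r s ^ 2 * p s ^ 1 * c s ^ 1 * d s ^ 0 +
      (2 * α ^ 2) * s ^ 2 * r s ^ 3 * p s ^ 0 * c s ^ 0 * d s ^ 1 = 0 := by
    intro s hs
    have := zero_of_deriv K1 hs ((((((((((((H (4 * α ^ 0) 0 0 1 0 1 s hs).add
      (H (2 * α ^ 0) 0 0 2 2 0 s hs)).add
      (H (4 * α ^ 0) 0 1 0 1 0 s hs)).add
      (H (10 * α ^ 0) 0 1 1 1 1 s hs)).add
      (H (3 * α ^ 2) 0 2 0 0 0 s hs)).add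
      (H (3 * α ^ 0) 0 2 0 0 2 s hs)).add
      (H (7 * α ^ 0) 0 2 0 2 0 s hs)).add
      (H (2 * α ^ 0) 0 3 0 3 0 s hs)).add
      (H (10 * α ^ 2) 1 1 1 0 0 s hs)).add
      (H (2 * α ^ 2) 2 0 2 0 0 s hs)).add
      (H (2 * α ^ 2) 2 2 0 0 0 s hs)).add
      (H (2 * α ^ 2) 2 3 0 1 0 s hs))
    norm_num at this
    linear_combination this
  have K3 : ∀ s ∈ Ioo lo hi, (16 * α ^ 0) * s ^ 0 * r s ^ 0 * p s ^ 1 * c s ^ 0 * d s ^ 1 +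
      (30 * α ^ 2) * s ^ 0 * r s ^ 0 * p s ^ 2 * c s ^ 0 * d s ^ 0 +
      (30 * α ^ 0) * s ^ 0 * r s ^ 0 * p s ^ 2 * c s ^ 0 * d s ^ 2 +
      (42 * α ^ 0) * s ^ 0 * r s ^ 0 * p s ^ 2 * c s ^ 2 * d s ^ 0 +
      (16 * α ^ 0) * s ^ 0 * r s ^ 1 * p s ^ 0 * c s ^ 1 * d s ^ 0 +
      (184 * α ^ 0) * s ^ 0 * r s ^ 1 * p s ^ 1 * c s ^ 1 * d s ^ 1 +
      (20 * α ^ 0) * s ^ 0 * r s ^ 1 * p s ^ 2 * c s ^ 3 * d s ^ 0 +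
      (30 * α ^ 2) * s ^ 0 * r s ^ 2 * p s ^ 0 * c s ^ 0 * d s ^ 0 +
      (50 * α ^ 0) * s ^ 0 * r s ^ 2 * p s ^ 0 * c s ^ 0 * d s ^ 2 +
      (70 * α ^ 0) * s ^ 0 * r s ^ 2 * p s ^ 0 * c s ^ 2 * d s ^ 0 +
      (106 * α ^ 0) * s ^ 0 * r s ^ 2 * p s ^ 1 * c s ^ 2 * d s ^ 1 +
      (30 * α ^ 2) * s ^ 0 * r s ^ 3 * p s ^ 0 * c s ^ 1 * d s ^ 0 +
      (48 * α ^ 0) * s ^ 0 * r s ^ 3 * p s ^ 0 * c s ^ 1 * d s ^ 2 +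
      (54 * α ^ 0) * s ^ 0 * r s ^ 3 * p s ^ 0 * c s ^ 3 * d s ^ 0 +
      (10 * α ^ 0) * s ^ 0 * r s ^ 4 * p s ^ 0 * c s ^ 4 * d s ^ 0 +
      (72 * α ^ 2) * s ^ 1 * r s ^ 1 * p s ^ 1 * c s ^ 0 * d s ^ 0 +
      (90 * α ^ 2) * s ^ 1 * r s ^ 2 * p s ^ 1 * c s ^ 1 * d s ^ 0 +
      (18 * α ^ 2) * s ^ 1 * r s ^ 3 * p s ^ 0 * c s ^ 0 * d s ^ 1 +
      (8 * α ^ 2) * s ^ 2 * r s ^ 0 * p s ^ 2 * c s ^ 0 * d s ^ 0 +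
      (20 * α ^ 2) * s ^ 2 * r s ^ 1 * p s ^ 2 * c s ^ 1 * d s ^ 0 +
      (8 * α ^ 2) * s ^ 2 * r s ^ 2 * p s ^ 0 * c s ^ 0 * d s ^ 0 +
      (16 * α ^ 2) * s ^ 2 * r s ^ 2 * p s ^ 1 * c s ^ 0 * d s ^ 1 +
      (20 * α ^ 2) * s ^ 2 * r s ^ 3 * p s ^ 0 * c s ^ 1 * d s ^ 0 +
      (10 * α ^ 2) * s ^ 2 * r s ^ 4 * p s ^ 0 * c s ^ 2 * d s ^ 0 = 0 := by
    intro s hs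
    have := zero_of_deriv K2 hs (((((((((((((((H (8 * α ^ 0) 0 0 1 1 0 s hs).add
      (H (14 * α ^ 0) 0 0 2 1 1 s hs)).add
      (H (8 * α ^ 0) 0 1 0 0 1 s hs)).add
      (H (16 * α ^ 2) 0 1 1 0 0 s hs)).add
      (H (16 * α ^ 0) 0 1 1 0 2 s hs)).add
      (H (28 * α ^ 0) 0 1 1 2 0 s hs)).add
      (H (34 * α ^ 0) 0 2 0 1 1 s hs)).add
      (H (10 * α ^ 0) 0 2 1 3 0 s hs)).add
      (H (16 * α ^ 0) 0 3 0 2 1 s hs)).add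
      (H (14 * α ^ 2) 1 0 2 0 0 s hs)).add
      (H (14 * α ^ 2) 1 2 0 0 0 s hs)).add
      (H (14 * α ^ 2) 1 3 0 1 0 s hs)).add
      (H (8 * α ^ 2) 2 1 1 0 0 s hs)).add
      (H (10 * α ^ 2) 2 2 1 1 0 s hs)).add
      (H (2 * α ^ 2) 2 3 0 0 1 s hs))
    norm_num at this
    linear_combination this
  have R := hpos 0 h0
  have f0 := F0 0 h0
  have k0 := K0 0 h0
  have k1 := K1 0 h0
  have k2 := K2 0 h0
  have k3 := K3 0 h0
  clear F0 F1 F1' K0 K1 K2 K3 H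
  norm_num at f0 k0 k1 k2 k3
  have hA : 0 < α ^ 2 * r 0 ^ 2 := by positivity
  rcases f0 with hc0 | hp0
  · rw [hc0] at k0 k1
    have hd0 : d 0 = 0 := by
      have : r 0 * d 0 = 0 := by linear_combination (1 / 2) * k0
      exact (mul_eq_zero.mp this).resolve_left R.ne'
    rw [hd0] at k1
    norm_num at k1
    rcases k1 with h | h
    · exact hα h
    · exact R.ne' h
  · rw [hp0] at k0 k1 k2 k3
    refine final_alg (c 0 * r 0) (d 0 * r 0) (α ^ 2 * r 0 ^ 2) hA ?_ ?_ ?_ ?_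
    · linear_combination k0
    · linear_combination k1
    · linear_combination k2
    · linear_combination k3

/-- Exclusion of Case (VI) in normalized form: `a(τ) = ατ` with `α ≠ 0`,
`b ≡ 0`, and `c ≠ 0` at some point is impossible. -/
theorem case_VI_cannot_occur :
    ¬ ∃ (lo hi : ℝ) (x y r c : ℝ → ℝ) (α τ₀ : ℝ),
      (0 : ℝ) ∈ Ioo lo hi ∧
      ContDiffOn ℝ (⊤ : ℕ∞) x (Ioo lo hi) ∧
      ContDiffOn ℝ (⊤ : ℕ∞) y (Ioo lo hi) ∧
      ContDiffOn ℝ (⊤ : ℕ∞) r (Ioo lo hi) ∧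
      ContDiffOn ℝ (⊤ : ℕ∞) c (Ioo lo hi) ∧
      (∀ τ ∈ Ioo lo hi, 0 < r τ) ∧
      α ≠ 0 ∧
      τ₀ ∈ Ioo lo hi ∧ c τ₀ ≠ 0 ∧
      (∀ τ ∈ Ioo lo hi, deriv (deriv x) τ = α * τ * r τ ^ 2) ∧
      (∀ τ ∈ Ioo lo hi, deriv (deriv y) τ = 0) ∧
      (∀ τ ∈ Ioo lo hi, deriv (deriv r) τ = r τ + c τ * r τ ^ 2) ∧
      (∀ τ ∈ Ioo lo hi, deriv (deriv c) τ = c τ) ∧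
      (∀ τ ∈ Ioo lo hi,
        deriv x τ ^ 2 + deriv y τ ^ 2 + deriv r τ ^ 2 = r τ ^ 2) := by
  rintro ⟨lo, hi, x, y, r, c, α, τ₀, h0, hx, hy, hr, hc, hpos, hα, -, -, ex, ey, er, ec, ha⟩
  have sx := smooth_derivs hx
  have sy := smooth_derivs hy
  have sr := smooth_derivs hr
  have sc := smooth_derivs hc
  refine core (c := c) (u := deriv x) (v := deriv y) (p := deriv r) (d := deriv c) h0 hα hpos
    ?_ ?_ ?_ ?_ ?_ ?_ ?_
  · intro s hs
    exact ex s hs ▸ (sx s hs).2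
  · intro s hs
    exact ey s hs ▸ (sy s hs).2
  · intro s hs
    exact (sr s hs).1
  · intro s hs
    exact er s hs ▸ (sr s hs).2
  · intro s hs
    exact (sc s hs).1
  · intro s hs
    have := (sc s hs).2
    rwa [ec s hs] at this
  · intro s hs
    linarith [ha s hs]
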